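/- Assume condition (★) holds. Then the map sending a subset I ⊆ {1,…,k} to the pair (⊕_{i∈I} U_i, ⊕_{i∉I} U_i) of internal direct sums is a bijection from { I ⊆ {1,…,k} : ∑_{i∈I} n_i = n } onto Fix(φ). -/

import Mathlib

open Module

namespace BZSVFix

variable {Γ : Type*} [Group Γ]

/-- A subspace `U ⊆ ℂ^d` is `Γ`-invariant for the representation `φ`. -/
def IsInvariant {d : ℕ} (φ : Representation ℂ Γ (Fin d → ℂ))
    (U : Submodule ℂ (Fin d → ℂ)) : Prop :=
  ∀ γ : Γ, ∀ x ∈ U, φ γ x ∈ U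

/-- A `Γ`-invariant subspace is irreducible if it is nonzero and contains no `Γ`-invariant
subspace other than `0` and itself. -/
def IsIrreducibleInv {d : ℕ} (φ : Representation ℂ Γ (Fin d → ℂ))
    (U : Submodule ℂ (Fin d → ℂ)) : Prop :=
  U ≠ ⊥ ∧ ∀ U' : Submodule ℂ (Fin d → ℂ), U' ≤ U → IsInvariant φ U' → U' = ⊥ ∨ U' = U

/-- Two `Γ`-invariant subspaces are isomorphic as `Γ`-modules: there is a `ℂ`-linear bijection
between them commuting with the action of every `φ γ`. -/
def IsoAsRep {d : ℕ} (φ : Representation ℂ Γ (Fin d → ℂ))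
    (U₁ U₂ : Submodule ℂ (Fin d → ℂ)) : Prop :=
  ∃ e : U₁ ≃ₗ[ℂ] U₂, ∀ (γ : Γ) (x : Fin d → ℂ) (hx : x ∈ U₁) (hγx : φ γ x ∈ U₁),
    ((e ⟨φ γ x, hγx⟩ : U₂) : Fin d → ℂ) = φ γ ((e ⟨x, hx⟩ : U₂) : Fin d → ℂ)

/-- `Fix(φ)`: the set of pairs `(V, W)` of `Γ`-invariant subspaces of `ℂ^d` with
`dim V = n`, `dim W = n + m`, `V ∩ W = 0` and `V + W = ℂ^d`. -/
def FixSet (n m : ℕ) {d : ℕ} (φ : Representation ℂ Γ (Fin d → ℂ)) :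
    Set (Submodule ℂ (Fin d → ℂ) × Submodule ℂ (Fin d → ℂ)) :=
  {p | IsInvariant φ p.1 ∧ IsInvariant φ p.2 ∧
    finrank ℂ p.1 = n ∧ finrank ℂ p.2 = n + m ∧ p.1 ⊓ p.2 = ⊥ ∧ p.1 ⊔ p.2 = ⊤}

/-- Condition (★): for every subset `I` of the index set with `∑_{i ∈ I} n_i = n`, the
constituents `U_i`, `i ∈ I`, and `U_j`, `j ∉ I`, are pairwise non-isomorphic. -/
def StarCondition {k : ℕ} (n : ℕ) (nι : Fin k → ℕ) {d : ℕ}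
    (φ : Representation ℂ Γ (Fin d → ℂ)) (U : Fin k → Submodule ℂ (Fin d → ℂ)) : Prop :=
  ∀ I : Finset (Fin k), (∑ i ∈ I, nι i) = n →
    ∀ i ∈ I, ∀ j ∉ I, ¬ IsoAsRep φ (U i) (U j)

section InvariantSubspaces

variable {d k : ℕ} {φ : Representation ℂ Γ (Fin d → ℂ)}

lemma IsInvariant.sup {P Q : Submodule ℂ (Fin d → ℂ)} (hP : IsInvariant φ P)
    (hQ : IsInvariant φ Q) : IsInvariant φ (P ⊔ Q) := by
  intro γ x hx
  obtain ⟨y, hy, z, hz, rfl⟩ := Submodule.mem_sup.1 hx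
  rw [map_add]
  exact Submodule.add_mem_sup (hP γ y hy) (hQ γ z hz)

lemma IsInvariant.inf {P Q : Submodule ℂ (Fin d → ℂ)} (hP : IsInvariant φ P)
    (hQ : IsInvariant φ Q) : IsInvariant φ (P ⊓ Q) :=
  fun γ x hx => ⟨hP γ x hx.1, hQ γ x hx.2⟩

lemma IsInvariant.iSup {ι : Sort*} {U : ι → Submodule ℂ (Fin d → ℂ)}
    (hU : ∀ i, IsInvariant φ (U i)) : IsInvariant φ (⨆ i, U i) := by
  intro γ
  change (⨆ i, U i) ≤ (⨆ i, U i).comap (φ γ)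
  exact iSup_le fun i x hx => Submodule.mem_iSup_of_mem i (hU i γ x hx)

lemma IsoAsRep.symm {P Q : Submodule ℂ (Fin d → ℂ)} (hP : IsInvariant φ P)
    (h : IsoAsRep φ P Q) : IsoAsRep φ Q P := by
  obtain ⟨e, he⟩ := h
  refine ⟨e.symm, fun γ x hx hγx => ?_⟩
  obtain ⟨⟨y, hy⟩, hyx⟩ := e.surjective ⟨x, hx⟩
  have h1 : (⟨φ γ x, hγx⟩ : Q) = e ⟨φ γ y, hP γ y hy⟩ := by
    ext1
    rw [he γ y hy, hyx]
  rw [h1, ← hyx]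
  simp

/-- Schur's lemma: an equivariant endomorphism carrying an irreducible invariant subspace into
another one not isomorphic to it vanishes there. -/
lemma IsIrreducibleInv.map_eq_zero {P Q : Submodule ℂ (Fin d → ℂ)} (hPi : IsInvariant φ P)
    (hP : IsIrreducibleInv φ P) (hQ : IsIrreducibleInv φ Q) (hPQ : ¬ IsoAsRep φ P Q)
    {f : (Fin d → ℂ) →ₗ[ℂ] (Fin d → ℂ)} (hf : ∀ γ x, f (φ γ x) = φ γ (f x))
    (hfPQ : ∀ x ∈ P, f x ∈ Q) {x : Fin d → ℂ} (hx : x ∈ P) : f x = 0 := by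
  have hker : IsInvariant φ (LinearMap.ker f) := fun γ y hy => by
    rw [LinearMap.mem_ker] at hy ⊢
    rw [hf, hy, map_zero]
  have hmap : IsInvariant φ (P.map f) := by
    rintro γ _ ⟨y, hy, rfl⟩
    exact ⟨φ γ y, hPi γ y hy, hf γ y⟩
  rcases hP.2 _ inf_le_left (hPi.inf hker) with h1 | h1
  · rcases hQ.2 _ (Submodule.map_le_iff_le_comap.2 hfPQ) hmap with h2 | h2
    · exact (Submodule.mem_bot ℂ).1 (h2 ▸ Submodule.mem_map_of_mem hx)
    · refine absurd ?_ hPQ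
      have hbij : Function.Bijective (f.restrict hfPQ) := by
        constructor
        · refine (injective_iff_map_eq_zero _).2 fun y hy => ?_
          have hy' : (y : Fin d → ℂ) ∈ P ⊓ LinearMap.ker f :=
            ⟨y.2, congrArg Subtype.val hy⟩
          rw [h1, Submodule.mem_bot] at hy'
          exact Subtype.ext hy'
        · rintro ⟨y, hy⟩
          rw [← h2] at hy
          obtain ⟨z, hz, rfl⟩ := hy
          exact ⟨⟨z, hz⟩, rfl⟩
      exact ⟨LinearEquiv.ofBijective _ hbij, fun γ y _ _ => hf γ y⟩
  · exact (h1.ge hx).2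

lemma projection_equivariant {P Q : Submodule ℂ (Fin d → ℂ)} (hP : IsInvariant φ P)
    (hQ : IsInvariant φ Q) (h : IsCompl P Q) (γ : Γ) (x : Fin d → ℂ) :
    P.projection Q h (φ γ x) = φ γ (P.projection Q h x) := by
  obtain ⟨y, hy, z, hz, rfl⟩ := Submodule.mem_sup.1 (h.sup_eq_top.ge (Submodule.mem_top (x := x)))
  simp only [map_add, Submodule.projection_apply_of_mem_left h hy,
    Submodule.projection_apply_of_mem_left h (hP γ y hy),
    Submodule.projection_apply_of_mem_right h hz,
    Submodule.projection_apply_of_mem_right h (hQ γ z hz), map_zero]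

variable {U : Fin k → Submodule ℂ (Fin d → ℂ)}

lemma isCompl_biSup_compl (hsum : DirectSum.IsInternal U) (I : Finset (Fin k)) :
    IsCompl (⨆ i ∈ I, U i) (⨆ i ∈ Iᶜ, U i) := by
  constructor
  · have h := hsum.submodule_iSupIndep.disjoint_biSup_biSup'
      (s := (I : Set (Fin k))) (t := ((Iᶜ : Finset (Fin k)) : Set (Fin k)))
      (by rw [Finset.disjoint_coe]; exact disjoint_compl_right) I.finite_toSet
    simpa only [Finset.mem_coe] using h
  · rw [codisjoint_iff, eq_top_iff, ← hsum.submodule_iSup_eq_top]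
    refine iSup_le fun i => ?_
    by_cases hi : i ∈ I
    · exact le_sup_of_le_left (le_biSup U hi)
    · exact le_sup_of_le_right (le_biSup U (Finset.mem_compl.2 hi))

lemma finrank_biSup (hsum : DirectSum.IsInternal U) (I : Finset (Fin k)) :
    finrank ℂ (⨆ i ∈ I, U i : Submodule ℂ (Fin d → ℂ)) = ∑ i ∈ I, finrank ℂ (U i) := by
  induction I using Finset.induction_on with
  | empty => simp
  | insert a s ha ih =>
    have hdis : Disjoint (U a) (⨆ i ∈ s, U i) :=
      hsum.submodule_iSupIndep.disjoint_biSup (y := (s : Set (Fin k))) ha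
    have h := Submodule.finrank_sup_add_finrank_inf_eq (U a) (⨆ i ∈ s, U i)
    rw [hdis.eq_bot, finrank_bot, add_zero, ih] at h
    rw [Finset.iSup_insert, Finset.sum_insert ha, h]

/-- Every invariant subspace has a complement that is a sum of some of the `U i`. -/
lemma exists_isCompl_biSup (hinv : ∀ i, IsInvariant φ (U i))
    (hirr : ∀ i, IsIrreducibleInv φ (U i)) (htop : ⨆ i, U i = ⊤)
    {V : Submodule ℂ (Fin d → ℂ)} (hV : IsInvariant φ V) :
    ∃ J : Finset (Fin k), IsCompl V (⨆ i ∈ J, U i) := by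
  obtain ⟨J, -, hJ⟩ := Finite.exists_le_maximal
    (p := fun J : Finset (Fin k) => Disjoint V (⨆ i ∈ J, U i)) (a := ∅) (by simp)
  refine ⟨J, hJ.1, ?_⟩
  rw [codisjoint_iff, eq_top_iff, ← htop]
  refine iSup_le fun i => ?_
  have hS : IsInvariant φ (V ⊔ ⨆ i ∈ J, U i) :=
    hV.sup (.iSup fun i => .iSup fun _ => hinv i)
  rcases (hirr i).2 _ inf_le_left ((hinv i).inf hS) with h | h
  · have hins : Disjoint V (⨆ j ∈ insert i J, U j) := by
      rw [Finset.iSup_insert, sup_comm]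
      exact hJ.1.disjoint_sup_right_of_disjoint_sup_left (disjoint_iff.2 h).symm
    have hi : i ∈ J := hJ.2 hins (Finset.subset_insert i J) (Finset.mem_insert_self i J)
    exact le_sup_of_le_right (le_biSup U hi)
  · exact inf_eq_left.1 h

/-- If no `U i` with `i ∈ I` is isomorphic to a `U j` with `j ∉ I`, then `⨁_{i ∈ I} U i` is the
only invariant complement of `⨁_{j ∉ I} U j`. -/
lemma eq_biSup_of_isCompl (hinv : ∀ i, IsInvariant φ (U i))
    (hirr : ∀ i, IsIrreducibleInv φ (U i)) (hsum : DirectSum.IsInternal U)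
    {I : Finset (Fin k)} (hI : ∀ i ∈ I, ∀ j ∉ I, ¬ IsoAsRep φ (U i) (U j))
    {V : Submodule ℂ (Fin d → ℂ)} (hV : IsInvariant φ V) (h : IsCompl V (⨆ i ∈ Iᶜ, U i)) :
    V = ⨆ i ∈ I, U i := by
  have hS (J : Finset (Fin k)) : IsInvariant φ (⨆ i ∈ J, U i) :=
    .iSup fun i => .iSup fun _ => hinv i
  have hle : ⨆ i ∈ I, U i ≤ V := by
    refine iSup₂_le fun i hi x hx => ?_
    rw [← Submodule.projection_apply_eq_zero_iff h.symm]
    obtain ⟨μ, hμ⟩ := (Submodule.mem_iSup_finset_iff_exists_sum _ _).1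
      (Submodule.projection_apply_mem h.symm x)
    rw [← hμ]
    refine Finset.sum_eq_zero fun j hj => ?_
    have hc : IsCompl (U j) (⨆ i ∈ ({j}ᶜ : Finset (Fin k)), U i) := by
      simpa using isCompl_biSup_compl hsum {j}
    have hz := (hirr i).map_eq_zero (hinv i) (hirr j) (hI i hi j (Finset.mem_compl.1 hj))
      (f := (U j).projection _ hc ∘ₗ Submodule.projection _ _ h.symm)
      (fun γ y => by
        simp only [LinearMap.comp_apply, projection_equivariant (hS _) hV h.symm,
          projection_equivariant (hinv j) (hS _) hc])
      (fun y _ => Submodule.projection_apply_mem hc _) hx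
    rw [LinearMap.comp_apply, ← hμ, map_sum, Finset.sum_eq_single_of_mem j hj,
      Submodule.projection_apply_left] at hz
    · exact hz
    · intro l _ hl
      refine Submodule.projection_apply_of_mem_right hc ?_
      exact le_biSup U (Finset.mem_compl.2 (by simpa using hl)) (μ l).2
  refine (eq_of_le_of_inf_le_of_sup_le hle ?_ ?_ (z := ⨆ i ∈ Iᶜ, U i)).symm
  · rw [h.inf_eq_bot]; exact bot_le
  · rw [(isCompl_biSup_compl hsum I).sup_eq_top]; exact le_top

lemma subset_of_biSup_le (hsum : DirectSum.IsInternal U) (hne : ∀ i, U i ≠ ⊥)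
    {I J : Finset (Fin k)} (h : ⨆ i ∈ I, U i ≤ ⨆ i ∈ J, U i) : I ⊆ J := by
  intro i hi
  by_contra hj
  have hdis : Disjoint (U i) (⨆ i ∈ J, U i) :=
    hsum.submodule_iSupIndep.disjoint_biSup (y := (J : Set (Fin k))) hj
  exact hne i (hdis.eq_bot_of_le ((le_biSup U hi).trans h))

end InvariantSubspaces

/-- Assume condition (★) holds. Then `I ↦ (⊕_{i ∈ I} U_i, ⊕_{i ∉ I} U_i)` is a bijection from
`{I ⊆ {1,…,k} : ∑_{i ∈ I} n_i = n}` onto `Fix(φ)`. -/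
theorem bijOn_fixSet {n m k : ℕ} (hn : 1 ≤ n)
    (φ : Representation ℂ Γ (Fin (2 * n + m) → ℂ))
    (U : Fin k → Submodule ℂ (Fin (2 * n + m) → ℂ)) (nι : Fin k → ℕ)
    (hinv : ∀ i, IsInvariant φ (U i)) (hirr : ∀ i, IsIrreducibleInv φ (U i))
    (hsum : DirectSum.IsInternal U)
    (hdim : ∀ i, finrank ℂ (U i) = nι i)
    (hstar : StarCondition n nι φ U) :
    Set.BijOn (fun I : Finset (Fin k) => ((⨆ i ∈ I, U i), (⨆ i ∈ Iᶜ, U i)))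
      {I : Finset (Fin k) | (∑ i ∈ I, nι i) = n} (FixSet n m φ) := by
  obtain rfl : nι = fun i => finrank ℂ (U i) := funext fun i => (hdim i).symm
  have hS (J : Finset (Fin k)) : IsInvariant φ (⨆ i ∈ J, U i) :=
    .iSup fun i => .iSup fun _ => hinv i
  refine ⟨fun I hI => ?_, fun I _ J _ hIJ => ?_, ?_⟩
  · have hc := isCompl_biSup_compl hsum I
    have hVI : finrank ℂ (⨆ i ∈ I, U i : Submodule ℂ (Fin (2 * n + m) → ℂ)) = n :=
      (finrank_biSup hsum I).trans hI
    have hd := Submodule.finrank_add_eq_of_isCompl hc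
    rw [finrank_fin_fun] at hd
    exact ⟨hS I, hS Iᶜ, hVI, by dsimp only; omega, hc.inf_eq_bot, hc.sup_eq_top⟩
  · have h := (Prod.ext_iff.1 hIJ).1
    exact (subset_of_biSup_le hsum (fun i => (hirr i).1) h.le).antisymm
      (subset_of_biSup_le hsum (fun i => (hirr i).1) h.ge)
  · rintro ⟨V, W⟩ ⟨hV, hW, hVn, -, hinf, hsup⟩
    dsimp only at hV hW hVn hinf hsup
    obtain ⟨J, hJ⟩ := exists_isCompl_biSup hinv hirr hsum.submodule_iSup_eq_top hV
    have hIn : ∑ i ∈ Jᶜ, finrank ℂ (U i) = n := by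
      have h1 := Submodule.finrank_add_eq_of_isCompl hJ
      have h2 := Submodule.finrank_add_eq_of_isCompl (isCompl_biSup_compl hsum J)
      rw [finrank_biSup hsum Jᶜ] at h2
      omega
    have hiso := hstar Jᶜ hIn
    obtain rfl : V = ⨆ i ∈ Jᶜ, U i :=
      eq_biSup_of_isCompl hinv hirr hsum hiso hV (by rwa [compl_compl])
    refine ⟨Jᶜ, hIn, Prod.ext rfl ?_⟩
    dsimp only
    rw [compl_compl]
    refine (eq_biSup_of_isCompl hinv hirr hsum (fun i hi j hj hij => ?_) hW
      (IsCompl.of_eq hinf hsup).symm).symm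
    exact hiso j (Finset.mem_compl.2 hj) i (by simpa using hi) (hij.symm (hinv i))


end BZSVFix
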